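/- Let n ≥ 2, r > 1, M > 0, L > 0, and let K : ℝ × ℝ → ℝ satisfy |K(x,y)| ≤ M and |K(x,y) − K(x',y')| ≤ L(|x − x'| + |y − y'|) for all x, y, x', y' ∈ [−r, r]. Define ρ : ℝ^n → ℝ by ρ(x₁,…,xₙ) = |det(K(x_i,x_j))_{1≤i,j≤n}|, and let D = { x ∈ ℝ^n : |x_i| ≤ r − 1 for all i, and x_i = x_j for some i ≠ j }. Then for every δ > 0 there exists an infinitely differentiable function f : ℝ^n → ℝ with compact support such that f(x) ≥ 1 for all x in some open neighborhood of D, and ∫_{[−r,r]^n} ( ‖∇f(x)‖² + f(x)² ) ρ(x) dx < δ. -/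

import Mathlib

open MeasureTheory

/-- If two rows of a matrix with entries bounded by `M` differ by at most `c` entrywise, then its
determinant is at most a constant multiple of `c`. -/
theorem abs_det_le_of_row_close {n : ℕ} {M c : ℝ} (hM : 0 < M)
    (A : Matrix (Fin n) (Fin n) ℝ) (hA : ∀ k l, |A k l| ≤ M) {i j : Fin n} (hij : i ≠ j)
    (hrow : ∀ l, |A i l - A j l| ≤ c) :
    |A.det| ≤ n.factorial * (c / M * M ^ n) := by
  rw [← Matrix.det_updateRow_add_smul_self A hij (-1), Matrix.det_apply]
  refine (Finset.abs_sum_le_sum_abs _ _).trans ?_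
  have key : ∀ σ : Equiv.Perm (Fin n), |Equiv.Perm.sign σ •
      ∏ k, (A.updateRow i (A i + (-1 : ℝ) • A j)) (σ k) k| ≤ c / M * M ^ n := by
    intro σ
    have hsign : |Equiv.Perm.sign σ •
        ∏ k, (A.updateRow i (A i + (-1 : ℝ) • A j)) (σ k) k| =
        |∏ k, (A.updateRow i (A i + (-1 : ℝ) • A j)) (σ k) k| := by
      rcases Int.units_eq_one_or (Equiv.Perm.sign σ) with h | h <;> simp [h]
    rw [hsign, Finset.abs_prod]
    calc ∏ k, |(A.updateRow i (A i + (-1 : ℝ) • A j)) (σ k) k|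
        ≤ ∏ k, ((if σ k = i then c / M else 1) * M) := by
          refine Finset.prod_le_prod (fun _ _ => abs_nonneg _) fun k _ => ?_
          rcases eq_or_ne (σ k) i with h | h
          · simpa [h, div_mul_cancel₀ c hM.ne', ← sub_eq_add_neg] using hrow k
          · simpa [h] using hA (σ k) k
      _ = c / M * M ^ n := by
          rw [Equiv.prod_comp σ (fun k => (if k = i then c / M else 1) * M),
            Finset.prod_mul_distrib]
          simp
  calc _ ≤ ∑ _σ : Equiv.Perm (Fin n), c / M * M ^ n := Finset.sum_le_sum fun σ _ => key σ
    _ = _ := by simp [Fintype.card_perm]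

/-- The integral of `G (x i - x j)` over a box is controlled by a one-dimensional integral of `G`. -/
theorem setIntegral_box_comp_sub_le {n : ℕ} {r : ℝ} (hr : 0 < r) {G : ℝ → ℝ}
    (hG : Continuous G) (hG0 : ∀ t, 0 ≤ G t) {i j : Fin n} (hij : i ≠ j) :
    ∫ x in Set.univ.pi fun _ : Fin n => Set.Icc (-r) r, G (x i - x j) ≤
      (2 * r) ^ (n - 1) * ∫ t in (-(2 * r))..(2 * r), G t := by
  obtain ⟨m, rfl⟩ : ∃ m, n = m + 1 := ⟨n - 1, by have := i.pos; omega⟩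
  obtain ⟨k, rfl⟩ := Fin.exists_succAbove_eq hij.symm
  have hbox : IsCompact (Set.univ.pi fun _ : Fin m => Set.Icc (-r) r) :=
    isCompact_univ_pi fun _ => isCompact_Icc
  have hmp := volume_preserving_piFinSuccAbove (fun _ : Fin (m + 1) => ℝ) i
  have hpre : (Set.univ.pi fun _ : Fin (m + 1) => Set.Icc (-r) r) =
      MeasurableEquiv.piFinSuccAbove (fun _ : Fin (m + 1) => ℝ) i ⁻¹'
        (Set.Icc (-r) r ×ˢ Set.univ.pi fun _ : Fin m => Set.Icc (-r) r) := by
    ext x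
    simp only [Set.mem_preimage, Set.mem_prod, Set.mem_univ_pi, Fin.forall_iff_succAbove i]
    rfl
  have hcont : Continuous fun p : ℝ × (Fin m → ℝ) => G (p.1 - p.2 k) := by fun_prop
  have hint : IntegrableOn (fun p : ℝ × (Fin m → ℝ) => G (p.1 - p.2 k))
      (Set.Icc (-r) r ×ˢ Set.univ.pi fun _ : Fin m => Set.Icc (-r) r) (volume.prod volume) :=
    hcont.continuousOn.integrableOn_compact (isCompact_Icc.prod hbox)
  have hinner : ∀ y ∈ Set.univ.pi fun _ : Fin m => Set.Icc (-r) r,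
      ∫ s in Set.Icc (-r) r, G (s - y k) ≤ ∫ t in (-(2 * r))..(2 * r), G t := by
    intro y hy
    have hyk := hy k (Set.mem_univ k)
    rw [integral_Icc_eq_integral_Ioc, ← intervalIntegral.integral_of_le (by linarith),
      intervalIntegral.integral_comp_sub_right]
    exact intervalIntegral.integral_mono_interval (by linarith [hyk.1, hyk.2]) (by linarith)
      (by linarith [hyk.1, hyk.2]) (ae_of_all _ hG0) (hG.intervalIntegrable _ _)
  calc ∫ x in Set.univ.pi fun _ : Fin (m + 1) => Set.Icc (-r) r, G (x i - x (i.succAbove k))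
      = ∫ p in Set.Icc (-r) r ×ˢ Set.univ.pi fun _ : Fin m => Set.Icc (-r) r,
          G (p.1 - p.2 k) := by
        rw [hpre]
        exact hmp.setIntegral_preimage_emb (MeasurableEquiv.measurableEmbedding _)
          (fun p : ℝ × (Fin m → ℝ) => G (p.1 - p.2 k)) _
    _ = ∫ y in Set.univ.pi fun _ : Fin m => Set.Icc (-r) r,
          ∫ s in Set.Icc (-r) r, G (s - y k) := by
        rw [Measure.volume_eq_prod, ← Measure.prod_restrict]
        rw [IntegrableOn, ← Measure.prod_restrict] at hint
        exact integral_prod_symm _ hint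
    _ ≤ ∫ _y in Set.univ.pi fun _ : Fin m => Set.Icc (-r) r,
          ∫ t in (-(2 * r))..(2 * r), G t := by
        refine integral_mono_of_nonneg (ae_of_all _ fun y => integral_nonneg fun s => hG0 _)
          (integrableOn_const hbox.measure_lt_top.ne) ?_
        exact (ae_restrict_iff' hbox.measurableSet).2 (ae_of_all _ hinner)
    _ = _ := by
        rw [setIntegral_const, smul_eq_mul, measureReal_def, volume_pi_pi]
        simp [ENNReal.toReal_ofReal (by linarith : 0 ≤ r + r), two_mul]

theorem integral_abs_div_sq_add {R e : ℝ} (hR : 0 ≤ R) (he : 0 < e) :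
    ∫ t in (-R)..R, |t| / (t ^ 2 + e) = Real.log (R ^ 2 + e) - Real.log e := by
  have hpos : ∀ t : ℝ, 0 < t ^ 2 + e := fun t => by positivity
  have hc : Continuous fun t : ℝ => |t| / (t ^ 2 + e) :=
    continuous_abs.div (by fun_prop) fun t => (hpos t).ne'
  have hhalf : ∫ t in (0 : ℝ)..R, |t| / (t ^ 2 + e) =
      (Real.log (R ^ 2 + e) - Real.log e) / 2 := by
    have hder : ∀ t ∈ Set.uIcc 0 R,
        HasDerivAt (fun t : ℝ => Real.log (t ^ 2 + e) / 2) (|t| / (t ^ 2 + e)) t := by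
      intro t ht
      rw [Set.uIcc_of_le hR] at ht
      have h := ((((hasDerivAt_id t).pow 2).add_const e).log (hpos t).ne').div_const 2
      refine h.congr_deriv ?_
      rw [abs_of_nonneg ht.1]
      simp
      field_simp
    rw [intervalIntegral.integral_eq_sub_of_hasDerivAt hder (hc.intervalIntegrable _ _)]
    simp
    ring
  have hneg : ∫ t in (-R)..0, |t| / (t ^ 2 + e) = ∫ t in (0 : ℝ)..R, |t| / (t ^ 2 + e) := by
    have h := intervalIntegral.integral_comp_neg (a := 0) (b := R)
      (fun t : ℝ => |t| / (t ^ 2 + e))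
    simpa using h.symm
  rw [← intervalIntegral.integral_add_adjacent_intervals (hc.intervalIntegrable _ 0)
    (hc.intervalIntegrable _ _), hneg, hhalf]
  ring

theorem abs_mul_log_sq_add_pow_four_le {R e t : ℝ} (he : 0 < e) (he1 : e ≤ 1) (ht : |t| ≤ R) :
    |t| * Real.log (t ^ 2 + e) ^ 4 ≤ 8 ^ 4 + R * Real.log (R ^ 2 + 1) ^ 4 := by
  have hR : 0 ≤ R := (abs_nonneg t).trans ht
  have hs : 0 < t ^ 2 + e := by positivity
  have ht2 : t ^ 2 ≤ R ^ 2 := by rw [← sq_abs t]; gcongr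
  rcases le_total (t ^ 2 + e) 1 with h | h
  · have hlog := Real.abs_log_mul_self_rpow_lt (t ^ 2 + e) (1 / 8) hs h (by norm_num)
    have hroot : ((t ^ 2 + e) ^ (1 / 8 : ℝ)) ^ 4 = √(t ^ 2 + e) := by
      rw [← Real.rpow_natCast, ← Real.rpow_mul hs.le, Real.sqrt_eq_rpow]
      norm_num
    have habs : |t| ≤ √(t ^ 2 + e) := Real.abs_le_sqrt (by linarith)
    have hpow : (Real.log (t ^ 2 + e) * (t ^ 2 + e) ^ (1 / 8 : ℝ)) ^ 4 ≤ 8 ^ 4 := by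
      rw [← Even.pow_abs (by decide : Even 4)]
      have : |Real.log (t ^ 2 + e) * (t ^ 2 + e) ^ (1 / 8 : ℝ)| ≤ 8 := by
        norm_num at hlog ⊢; exact hlog.le
      gcongr
    rw [mul_pow, hroot] at hpow
    have h1 : |t| * Real.log (t ^ 2 + e) ^ 4 ≤ √(t ^ 2 + e) * Real.log (t ^ 2 + e) ^ 4 := by
      gcongr
    have h2 : 0 ≤ R * Real.log (R ^ 2 + 1) ^ 4 := by positivity
    linarith
  · have h0 : 0 ≤ Real.log (t ^ 2 + e) := Real.log_nonneg h
    have h1 : |t| * Real.log (t ^ 2 + e) ^ 4 ≤ R * Real.log (R ^ 2 + 1) ^ 4 := by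
      gcongr
    linarith

theorem abs_log_sq_add_le {R l t : ℝ} (hl : 1 ≤ l) (ht : |t| ≤ R) :
    |Real.log (t ^ 2 + Real.exp (-2 * l))| ≤ (2 + Real.log (R ^ 2 + 1)) * l := by
  have he := Real.exp_pos (-2 * l)
  have he1 : Real.exp (-2 * l) ≤ 1 := Real.exp_le_one_iff.2 (by linarith)
  have ht2 : t ^ 2 ≤ R ^ 2 := by rw [← sq_abs t]; gcongr
  have hR : 0 ≤ Real.log (R ^ 2 + 1) := Real.log_nonneg (by nlinarith [sq_nonneg R])
  have hlow : -2 * l ≤ Real.log (t ^ 2 + Real.exp (-2 * l)) := by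
    rw [Real.le_log_iff_exp_le (by positivity)]
    nlinarith [sq_nonneg t]
  have hup : Real.log (t ^ 2 + Real.exp (-2 * l)) ≤ Real.log (R ^ 2 + 1) := by
    gcongr
  rw [abs_le]
  constructor <;> nlinarith

/-- The origin has zero capacity on the line for the Dirichlet integral with weight `|t|`; the test
function is `(log (t² + ε²) / log ε)²` for small `ε`. -/
theorem exists_smooth_log_cutoff {R : ℝ} (hR : 0 ≤ R) {δ : ℝ} (hδ : 0 < δ) :
    ∃ w : ℝ → ℝ, ContDiff ℝ (⊤ : ℕ∞) w ∧ (∀ t, 0 ≤ w t) ∧ 1 < w 0 ∧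
      ∫ t in (-R)..R, (deriv w t ^ 2 + w t ^ 2) * |t| < δ := by
  set B : ℝ := 2 + Real.log (R ^ 2 + 1) with hB
  set C : ℝ := 8 ^ 4 + R * Real.log (R ^ 2 + 1) ^ 4 with hC
  have hBpos : 0 ≤ B := by
    have : 0 ≤ Real.log (R ^ 2 + 1) := Real.log_nonneg (by nlinarith [sq_nonneg R])
    linarith
  have hCpos : 0 ≤ C := by positivity
  set A : ℝ := 16 * B ^ 2 * (B + 2) + 2 * R * C with hA
  have hApos : 0 ≤ A := by positivity
  obtain ⟨l, hl1, hlA⟩ : ∃ l : ℝ, 1 ≤ l ∧ A / l < δ := by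
    refine ⟨A / δ + 1, by have : 0 ≤ A / δ := by positivity
                          linarith, ?_⟩
    rw [div_lt_iff₀ (by positivity)]
    field_simp
    linarith
  have hl0 : 0 < l := by linarith
  set e : ℝ := Real.exp (-2 * l) with hedef
  have he : 0 < e := Real.exp_pos _
  have he1 : e ≤ 1 := Real.exp_le_one_iff.2 (by linarith)
  have hpos : ∀ t : ℝ, 0 < t ^ 2 + e := fun t => by positivity
  have hsmooth : ContDiff ℝ (⊤ : ℕ∞) fun t : ℝ => (Real.log (t ^ 2 + e) / l) ^ 2 :=
    ((ContDiff.log (by fun_prop) fun t => (hpos t).ne').div_const l).pow 2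
  have hder : ∀ t : ℝ, deriv (fun t : ℝ => (Real.log (t ^ 2 + e) / l) ^ 2) t =
      4 * (Real.log (t ^ 2 + e) / l) * (t / (t ^ 2 + e)) / l := by
    intro t
    have h := (((((hasDerivAt_id t).pow 2).add_const e).log (hpos t).ne').div_const l).pow 2
    refine (HasDerivAt.congr_deriv h ?_).deriv
    simp
    field_simp
    ring
  refine ⟨fun t => (Real.log (t ^ 2 + e) / l) ^ 2, hsmooth, fun t => sq_nonneg _, ?_, ?_⟩
  · have : Real.log e = -2 * l := Real.log_exp _
    simp only [ne_eq, OfNat.ofNat_ne_zero, not_false_eq_true, zero_pow, zero_add, this]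
    rw [mul_div_assoc, div_self hl0.ne']
    norm_num
  have hG : Continuous fun t : ℝ => |t| / (t ^ 2 + e) :=
    continuous_abs.div (by fun_prop) fun t => (hpos t).ne'
  have hdc : Continuous (deriv fun t : ℝ => (Real.log (t ^ 2 + e) / l) ^ 2) :=
    hsmooth.continuous_deriv (by simp)
  have hwc := hsmooth.continuous
  have hpt : ∀ t ∈ Set.Icc (-R) R,
      (deriv (fun t : ℝ => (Real.log (t ^ 2 + e) / l) ^ 2) t ^ 2 +
        ((Real.log (t ^ 2 + e) / l) ^ 2) ^ 2) * |t| ≤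
      16 * B ^ 2 / l ^ 2 * (|t| / (t ^ 2 + e)) + C / l ^ 4 := by
    intro t ht
    have htR : |t| ≤ R := abs_le.2 ht
    have hu : (Real.log (t ^ 2 + e) / l) ^ 2 ≤ B ^ 2 := by
      rw [← sq_abs, abs_div, abs_of_pos hl0]
      have : |Real.log (t ^ 2 + e)| / l ≤ B := by
        rw [div_le_iff₀ hl0]; exact abs_log_sq_add_le hl1 htR
      gcongr
    have hq : (t / (t ^ 2 + e)) ^ 2 * |t| ≤ |t| / (t ^ 2 + e) := by
      have h1 : (t / (t ^ 2 + e)) ^ 2 * |t| =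
          t ^ 2 / (t ^ 2 + e) * (|t| / (t ^ 2 + e)) := by ring
      rw [h1]
      refine mul_le_of_le_one_left (by positivity) ?_
      rw [div_le_one (hpos t)]
      linarith
    have hv := abs_mul_log_sq_add_pow_four_le he he1 htR
    rw [hder]
    calc _ = 16 / l ^ 2 * ((Real.log (t ^ 2 + e) / l) ^ 2 * ((t / (t ^ 2 + e)) ^ 2 * |t|))
          + (|t| * Real.log (t ^ 2 + e) ^ 4) / l ^ 4 := by ring
      _ ≤ 16 / l ^ 2 * (B ^ 2 * (|t| / (t ^ 2 + e))) + C / l ^ 4 := by gcongr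
      _ = _ := by ring
  have hlog : Real.log (R ^ 2 + e) - Real.log e ≤ (B + 2) * l := by
    have h1 : Real.log e = -2 * l := Real.log_exp _
    have h2 := (le_abs_self _).trans (abs_log_sq_add_le hl1 (abs_of_nonneg hR).le)
    rw [h1]
    linarith
  have hl4 : l ≤ l ^ 4 := le_self_pow₀ hl1 (by norm_num)
  calc _ ≤ ∫ t in (-R)..R, (16 * B ^ 2 / l ^ 2 * (|t| / (t ^ 2 + e)) + C / l ^ 4) := by
        refine intervalIntegral.integral_mono_on (by linarith) ?_ ?_ hpt
        · exact Continuous.intervalIntegrable (by fun_prop) _ _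
        · exact Continuous.intervalIntegrable (by fun_prop) _ _
    _ = 16 * B ^ 2 / l ^ 2 * (Real.log (R ^ 2 + e) - Real.log e) + 2 * R * C / l ^ 4 := by
        rw [intervalIntegral.integral_add (Continuous.intervalIntegrable (by fun_prop) _ _)
          (by simp), intervalIntegral.integral_const_mul, integral_abs_div_sq_add hR he,
          intervalIntegral.integral_const, smul_eq_mul]
        ring
    _ ≤ 16 * B ^ 2 / l ^ 2 * ((B + 2) * l) + 2 * R * C / l := by gcongr
    _ = A / l := by rw [hA]; field_simp
    _ < δ := hlA

theorem sum_sq_fderiv_add_sq_sum_comp_sub_le {n : ℕ} (hn : 1 ≤ n) {w : ℝ → ℝ}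
    (hw : Differentiable ℝ w) (s : Finset (Fin n × Fin n)) (x : Fin n → ℝ) :
    (∑ k, (fderiv ℝ (fun x : Fin n → ℝ => ∑ p ∈ s, w (x p.1 - x p.2)) x
        (Pi.single k 1)) ^ 2) + (∑ p ∈ s, w (x p.1 - x p.2)) ^ 2 ≤
      n * s.card * ∑ p ∈ s, (deriv w (x p.1 - x p.2) ^ 2 + w (x p.1 - x p.2) ^ 2) := by
  have hF : HasFDerivAt (fun x : Fin n → ℝ => ∑ p ∈ s, w (x p.1 - x p.2))
      (∑ p ∈ s, deriv w (x p.1 - x p.2) •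
        (ContinuousLinearMap.proj (R := ℝ) (φ := fun _ : Fin n => ℝ) p.1 -
          ContinuousLinearMap.proj p.2)) x := by
    refine HasFDerivAt.fun_sum fun p _ => ?_
    exact (hw _).hasDerivAt.comp_hasFDerivAt x
      ((hasFDerivAt_apply p.1 x).sub (hasFDerivAt_apply p.2 x))
  have hgrad : ∀ k, (fderiv ℝ (fun x : Fin n → ℝ => ∑ p ∈ s, w (x p.1 - x p.2)) x
      (Pi.single k 1)) ^ 2 ≤ s.card * ∑ p ∈ s, deriv w (x p.1 - x p.2) ^ 2 := by
    intro k
    rw [hF.fderiv, _root_.sum_apply]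
    refine sq_sum_le_card_mul_sum_sq.trans ?_
    refine mul_le_mul_of_nonneg_left (Finset.sum_le_sum fun p _ => ?_) (Nat.cast_nonneg _)
    have hcoef : ((Pi.single k (1 : ℝ) : Fin n → ℝ) p.1 -
        (Pi.single k (1 : ℝ) : Fin n → ℝ) p.2) ^ 2 ≤ 1 := by
      simp only [Pi.single_apply]
      split_ifs <;> norm_num
    calc _ = deriv w (x p.1 - x p.2) ^ 2 * ((Pi.single k (1 : ℝ) : Fin n → ℝ) p.1 -
          (Pi.single k (1 : ℝ) : Fin n → ℝ) p.2) ^ 2 := by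
          simp [mul_pow]
      _ ≤ _ := mul_le_of_le_one_right (sq_nonneg _) hcoef
  have hval : (∑ p ∈ s, w (x p.1 - x p.2)) ^ 2 ≤ s.card * ∑ p ∈ s, w (x p.1 - x p.2) ^ 2 :=
    sq_sum_le_card_mul_sum_sq
  have hn' : (1 : ℝ) ≤ n := by exact_mod_cast hn
  have hval0 : 0 ≤ s.card * ∑ p ∈ s, w (x p.1 - x p.2) ^ 2 := by positivity
  calc _ ≤ (∑ _k : Fin n, s.card * ∑ p ∈ s, deriv w (x p.1 - x p.2) ^ 2) +
        n * (s.card * ∑ p ∈ s, w (x p.1 - x p.2) ^ 2) := by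
        refine add_le_add (Finset.sum_le_sum fun k _ => hgrad k) (hval.trans ?_)
        exact le_mul_of_one_le_left hval0 hn'
    _ = _ := by
        rw [Finset.sum_add_distrib]
        simp
        ring

/-- Finite-dimensional content of the non-collision theorem: if `K` is bounded
by `M` and `L`-Lipschitz on `[-r,r]²`, and `ρ(x) = |det (K(x_i,x_j))|`, then the
diagonal set `D` of colliding configurations inside `[-(r-1), r-1]^n` has zero
capacity for the weighted Dirichlet integral `∫ (‖∇f‖² + f²) ρ dx`. -/
theorem collision_set_zero_capacity (n : ℕ) (hn : 2 ≤ n) (r M L : ℝ)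
    (hr : 1 < r) (hM : 0 < M) (hL : 0 < L) (K : ℝ → ℝ → ℝ)
    (hKbdd : ∀ x ∈ Set.Icc (-r) r, ∀ y ∈ Set.Icc (-r) r, |K x y| ≤ M)
    (hKlip : ∀ x ∈ Set.Icc (-r) r, ∀ y ∈ Set.Icc (-r) r,
      ∀ x' ∈ Set.Icc (-r) r, ∀ y' ∈ Set.Icc (-r) r,
        |K x y - K x' y'| ≤ L * (|x - x'| + |y - y'|))
    (ρ : (Fin n → ℝ) → ℝ)
    (hρ : ∀ x : Fin n → ℝ, ρ x = |(Matrix.of fun i j => K (x i) (x j)).det|)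
    (D : Set (Fin n → ℝ))
    (hD : D = {x : Fin n → ℝ |
      (∀ i, |x i| ≤ r - 1) ∧ ∃ i j : Fin n, i ≠ j ∧ x i = x j})
    (δ : ℝ) (hδ : 0 < δ) :
    ∃ f : (Fin n → ℝ) → ℝ, ContDiff ℝ (⊤ : ℕ∞) f ∧ HasCompactSupport f ∧
      (∃ U : Set (Fin n → ℝ), IsOpen U ∧ D ⊆ U ∧ ∀ x ∈ U, 1 ≤ f x) ∧
      ∫ x in Set.univ.pi fun _ : Fin n => Set.Icc (-r) r,
        ((∑ i, (fderiv ℝ f x (Pi.single i 1)) ^ 2) + (f x) ^ 2) * ρ x < δ := by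
  have hr0 : 0 < r := by linarith
  set box : Set (Fin n → ℝ) := Set.univ.pi fun _ : Fin n => Set.Icc (-r) r with hboxdef
  have hbox : IsCompact box := isCompact_univ_pi fun _ => isCompact_Icc
  set s : Finset (Fin n × Fin n) := Finset.univ.offDiag with hs
  have hsne : ∀ p ∈ s, p.1 ≠ p.2 := fun p hp => (Finset.mem_offDiag.1 hp).2.2
  set C : ℝ := n.factorial * (L / M * M ^ n) with hC
  have hρle : ∀ x ∈ box, ∀ p ∈ s, ρ x ≤ C * |x p.1 - x p.2| := by
    intro x hx p hp
    have hx' : ∀ k, x k ∈ Set.Icc (-r) r := fun k => hx k (Set.mem_univ k)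
    rw [hρ]
    refine (abs_det_le_of_row_close hM _ (c := L * |x p.1 - x p.2|)
      (fun k l => hKbdd _ (hx' k) _ (hx' l)) (hsne p hp) fun l => ?_).trans_eq (by rw [hC]; ring)
    simpa using hKlip _ (hx' p.1) _ (hx' l) _ (hx' p.2) _ (hx' l)
  set A : ℝ := n * s.card * C * (s.card * (2 * r) ^ (n - 1)) with hA
  have hA0 : 0 ≤ A := by positivity
  obtain ⟨w, hw, hw0, hw1, hwint⟩ := exists_smooth_log_cutoff (R := 2 * r) (by linarith)
    (δ := δ / (A + 1)) (by positivity)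
  set G : ℝ → ℝ := fun t => (deriv w t ^ 2 + w t ^ 2) * |t| with hG
  have hG0 : ∀ t, 0 ≤ G t := fun t => by positivity
  have hGc : Continuous G := by
    have h1 : Continuous (deriv w) := hw.continuous_deriv (by simp)
    have h2 := hw.continuous
    fun_prop
  set F : (Fin n → ℝ) → ℝ := fun x => ∑ p ∈ s, w (x p.1 - x p.2) with hF
  have hFsmooth : ContDiff ℝ (⊤ : ℕ∞) F :=
    ContDiff.sum fun p _ => hw.comp (by fun_prop)
  let χ : ContDiffBump (0 : Fin n → ℝ) := ⟨r + 1, r + 2, by linarith, by linarith⟩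
  have hχ : ∀ x ∈ Metric.ball (0 : Fin n → ℝ) (r + 1), χ x = 1 := fun x hx =>
    χ.one_of_mem_closedBall (Metric.ball_subset_closedBall hx)
  have hfF : ∀ x ∈ Metric.ball (0 : Fin n → ℝ) (r + 1), χ x * F x = F x := fun x hx => by
    rw [hχ x hx, one_mul]
  have hball : ∀ x : Fin n → ℝ, (∀ k, |x k| ≤ r) → x ∈ Metric.ball (0 : Fin n → ℝ) (r + 1) := by
    intro x hx
    rw [mem_ball_zero_iff]
    exact ((pi_norm_le_iff_of_nonneg hr0.le).2 hx).trans_lt (by linarith)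
  refine ⟨fun x => χ x * F x, χ.contDiff.mul hFsmooth, χ.hasCompactSupport.mul_right,
    ⟨Metric.ball 0 (r + 1) ∩ F ⁻¹' Set.Ioi 1,
      Metric.isOpen_ball.inter (isOpen_Ioi.preimage hFsmooth.continuous), ?_, ?_⟩, ?_⟩
  · rw [hD]
    rintro x ⟨hx, i, j, hij, hxij⟩
    refine ⟨hball x fun k => (hx k).trans (by linarith), ?_⟩
    have hmem : (i, j) ∈ s := by simp [hs, hij]
    have hle := Finset.single_le_sum (f := fun p : Fin n × Fin n => w (x p.1 - x p.2))
      (fun p _ => hw0 _) hmem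
    simp only [hxij, sub_self] at hle
    exact hw1.trans_le hle
  · rintro x ⟨hx, hFx⟩
    simp only [hfF x hx]
    exact hFx.le
  have hpt : ∀ x ∈ box, ((∑ k, (fderiv ℝ (fun x => χ x * F x) x (Pi.single k 1)) ^ 2) +
      (χ x * F x) ^ 2) * ρ x ≤ n * s.card * C * ∑ p ∈ s, G (x p.1 - x p.2) := by
    intro x hx
    have hxb := hball x fun k => abs_le.2 (hx k (Set.mem_univ k))
    have heq : (fun x => χ x * F x) =ᶠ[nhds x] F :=
      Filter.eventually_of_mem (Metric.isOpen_ball.mem_nhds hxb) hfF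
    have hρ0 : 0 ≤ ρ x := by rw [hρ]; exact abs_nonneg _
    rw [heq.fderiv_eq, hfF x hxb]
    calc _ ≤ (n * s.card * ∑ p ∈ s,
          (deriv w (x p.1 - x p.2) ^ 2 + w (x p.1 - x p.2) ^ 2)) * ρ x := by
          gcongr
          exact sum_sq_fderiv_add_sq_sum_comp_sub_le (by omega) (hw.differentiable (by simp)) s x
      _ = n * s.card * ∑ p ∈ s,
          (deriv w (x p.1 - x p.2) ^ 2 + w (x p.1 - x p.2) ^ 2) * ρ x := by
          rw [mul_assoc, Finset.sum_mul]
      _ ≤ n * s.card * ∑ p ∈ s, (deriv w (x p.1 - x p.2) ^ 2 + w (x p.1 - x p.2) ^ 2) *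
          (C * |x p.1 - x p.2|) := by
          gcongr with p hp
          exact hρle x hx p hp
      _ = _ := by
          rw [mul_assoc _ C, Finset.mul_sum (a := C)]
          congr 1
          exact Finset.sum_congr rfl fun p _ => by simp only [hG]; ring
  have hGint : ∀ p : Fin n × Fin n, IntegrableOn (fun x : Fin n → ℝ => G (x p.1 - x p.2)) box :=
    fun p => (Continuous.continuousOn (by fun_prop)).integrableOn_compact hbox
  calc _ ≤ ∫ x in box, n * s.card * C * ∑ p ∈ s, G (x p.1 - x p.2) := by
        refine integral_mono_of_nonneg (ae_of_all _ fun x => ?_)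
          ((integrable_finsetSum s fun p _ => hGint p).const_mul _)
          ((ae_restrict_iff' hbox.measurableSet).2 (ae_of_all _ hpt))
        have hρ0 : 0 ≤ ρ x := by rw [hρ]; exact abs_nonneg _
        simp only [Pi.zero_apply]
        positivity
    _ = n * s.card * C * ∑ p ∈ s, ∫ x in box, G (x p.1 - x p.2) := by
        rw [integral_const_mul, integral_finsetSum s fun p _ => hGint p]
    _ ≤ n * s.card * C * ∑ _p ∈ s, (2 * r) ^ (n - 1) * ∫ t in (-(2 * r))..(2 * r), G t := by
        gcongr with p hp
        exact setIntegral_box_comp_sub_le hr0 hGc hG0 (hsne p hp)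
    _ = A * ∫ t in (-(2 * r))..(2 * r), G t := by
        rw [Finset.sum_const, nsmul_eq_mul, hA]
        ring
    _ ≤ A * (δ / (A + 1)) := by gcongr
    _ < δ := by
        rw [← mul_div_assoc, div_lt_iff₀ (by positivity)]
        linarith
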